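/- Let C be a finite dimensional algebra of global dimension exactly 2 and M a finitely generated C-module. Then id_C M ≤ 1 if and only if Hom_C(M, τ_C Ω_C DC) = 0. -/

import Mathlib

open CategoryTheory MulOpposite

open CategoryTheory MulOpposite

/-! Core definitions: right `A`-modules are modules over `Aᵐᵒᵖ`. -/

/-- The category of (small) modules over a ring `R`.  For a `k`-algebra `A`,
right `A`-modules are `Mdl Aᵐᵒᵖ`. -/
abbrev Mdl (R : Type) [Ring R] := ModuleCat.{0} R

section Generic

variable (R : Type) [Ring R]

/-- `f : P → M` is a projective cover: `P` projective, `f` surjective with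
superfluous kernel. -/
def IsProjCover {P M : Mdl R} (f : P →ₗ[R] M) : Prop :=
  Module.Projective R P ∧ Function.Surjective f ∧
    ∀ N : Submodule R P, N ⊔ LinearMap.ker f = ⊤ → N = ⊤

/-- `f : M → I` is an injective envelope: `I` injective, `f` injective with
essential image. -/
def IsInjEnv {M I : Mdl R} (f : M →ₗ[R] I) : Prop :=
  Module.Injective R I ∧ Function.Injective f ∧
    ∀ K : Submodule R I, K ⊓ LinearMap.range f = ⊥ → K = ⊥

/-- `Hom_R(X, Y) = 0`. -/
def HomZero (X Y : Mdl R) : Prop := ∀ f : X →ₗ[R] Y, f = 0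

/-- `X ∈ Gen M`: `X` is an epimorphic image of a finite direct sum of copies of `M`. -/
def MemGen (M X : Mdl R) : Prop :=
  ∃ (d : ℕ) (f : (Fin d → M) →ₗ[R] X), Function.Surjective f

/-- `X ∈ add M`: `X` is a direct summand of a finite direct sum of copies of `M`. -/
def MemAdd (M X : Mdl R) : Prop :=
  ∃ (n : ℕ) (s : X →ₗ[R] (Fin n → M)) (r : (Fin n → M) →ₗ[R] X),
    r.comp s = LinearMap.id

/-- projective dimension at most 1: a length-one projective resolution exists. -/
def PdLE1 (M : Mdl R) : Prop :=
  ∃ (P1 P0 : Mdl R) (d1 : P1 →ₗ[R] P0) (d0 : P0 →ₗ[R] M),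
    Module.Projective R P1 ∧ Module.Projective R P0 ∧
    Function.Injective d1 ∧ Function.Surjective d0 ∧
    LinearMap.range d1 = LinearMap.ker d0

/-- projective dimension at most 2. -/
def PdLE2 (M : Mdl R) : Prop :=
  ∃ (P2 P1 P0 : Mdl R) (d2 : P2 →ₗ[R] P1) (d1 : P1 →ₗ[R] P0) (d0 : P0 →ₗ[R] M),
    Module.Projective R P2 ∧ Module.Projective R P1 ∧ Module.Projective R P0 ∧
    Function.Injective d2 ∧ Function.Surjective d0 ∧
    LinearMap.range d2 = LinearMap.ker d1 ∧ LinearMap.range d1 = LinearMap.ker d0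

/-- injective dimension at most 1. -/
def IdLE1 (M : Mdl R) : Prop :=
  ∃ (I0 I1 : Mdl R) (d0 : M →ₗ[R] I0) (d1 : I0 →ₗ[R] I1),
    Module.Injective R I0 ∧ Module.Injective R I1 ∧
    Function.Injective d0 ∧ Function.Surjective d1 ∧
    LinearMap.range d0 = LinearMap.ker d1

/-- global dimension at most 2 (every module has projective dimension ≤ 2). -/
def GlDimLE2 : Prop := ∀ M : Mdl R, PdLE2 R M

/-- global dimension exactly 2. -/
def GlDimEq2 : Prop := GlDimLE2 R ∧ ¬ ∀ M : Mdl R, PdLE1 R M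

/-- `W` is a first syzygy `Ω M` of `M` (kernel of a projective cover). -/
def IsSyzygy (M W : Mdl R) : Prop :=
  ∃ (P : Mdl R) (f : P →ₗ[R] M), IsProjCover R f ∧
    Nonempty (W ≃ₗ[R] LinearMap.ker f)

/-- `W` is a first cosyzygy `Ω⁻¹ M` of `M` (cokernel of an injective envelope). -/
def IsCosyzygy (M W : Mdl R) : Prop :=
  ∃ (I : Mdl R) (f : M →ₗ[R] I), IsInjEnv R f ∧
    Nonempty (W ≃ₗ[R] (I ⧸ LinearMap.range f))

/-- `P1 --d1--> P0 --d0--> M → 0` is a minimal projective presentation. -/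
def IsMinPres {P1 P0 M : Mdl R} (d1 : P1 →ₗ[R] P0) (d0 : P0 →ₗ[R] M) : Prop :=
  IsProjCover R d0 ∧ Module.Projective R P1 ∧
  LinearMap.range d1 = LinearMap.ker d0 ∧
  ∀ N : Submodule R P1, N ⊔ LinearMap.ker d1 = ⊤ → N = ⊤

/-- `Ext¹_R(X, Y) = 0`, expressed as: every short exact sequence
`0 → Y → Z → X → 0` splits. -/
def Ext1Zero (X Y : Mdl R) : Prop :=
  ∀ (Z : Mdl R) (i : Y →ₗ[R] Z) (p : Z →ₗ[R] X),
    Function.Injective i → Function.Surjective p →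
    LinearMap.range i = LinearMap.ker p →
    ∃ s : X →ₗ[R] Z, p.comp s = LinearMap.id

/-- partial tilting module: `pd ≤ 1` and `Ext¹(M,M) = 0`. -/
def PartialTilting (M : Mdl R) : Prop := PdLE1 R M ∧ Ext1Zero R M M

/-- tilting module: partial tilting plus a coresolution
`0 → R → T' → T'' → 0` with `T', T'' ∈ add M` of the regular module. -/
def IsTilting (M : Mdl R) : Prop :=
  PartialTilting R M ∧
  ∃ (T' T'' : Mdl R) (i : ModuleCat.of R R →ₗ[R] T') (p : T' →ₗ[R] T''),
    MemAdd R M T' ∧ MemAdd R M T'' ∧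
    Function.Injective i ∧ Function.Surjective p ∧
    LinearMap.range i = LinearMap.ker p

/-- an indecomposable (nonzero) module. -/
def Indecomp (M : Mdl R) : Prop :=
  Nontrivial M ∧ ∀ (U V : Submodule R M), IsCompl U V → U = ⊥ ∨ V = ⊥

/-- the number of isomorphism classes of simple `R`-modules is `n`. -/
def SimpleCount (n : ℕ) : Prop :=
  ∃ S : Fin n → Mdl R,
    (∀ i, IsSimpleModule R (S i)) ∧
    (∀ i j, Nonempty ((S i) ≃ₗ[R] (S j)) → i = j) ∧
    ∀ X : Mdl R, IsSimpleModule R X → ∃ i, Nonempty (X ≃ₗ[R] S i)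

end Generic

section Duality

variable (k : Type) [Field k] (A : Type) [Ring A] [Algebra k A]

/-- `N` (a right `A`-module) is the `k`-linear dual `D M` of the left `A`-module `M`:
witnessed by a nondegenerate balanced `k`-bilinear pairing. -/
def IskDual (N : Mdl Aᵐᵒᵖ) (M : Mdl A) : Prop :=
  ∃ φ : N → M → k,
    (∀ n n' m, φ (n + n') m = φ n m + φ n' m) ∧
    (∀ n m m', φ n (m + m') = φ n m + φ n m') ∧
    (∀ (c : k) n m, φ n ((algebraMap k A c) • m) = c * φ n m) ∧
    (∀ (a : A) n m, φ (op a • n) m = φ n (a • m)) ∧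
    (∀ n, (∀ m, φ n m = 0) → n = 0) ∧
    (∀ m, (∀ n, φ n m = 0) → m = 0)

/-- `T = τ M`: the Auslander–Reiten translate of the right `A`-module `M`,
i.e. the `k`-dual of the transpose `Tr M` computed from a minimal projective
presentation. -/
def IsTau (M T : Mdl Aᵐᵒᵖ) : Prop :=
  ∃ (P1 P0 : Mdl Aᵐᵒᵖ) (d1 : P1 →ₗ[Aᵐᵒᵖ] P0) (d0 : P0 →ₗ[Aᵐᵒᵖ] M),
    IsMinPres Aᵐᵒᵖ d1 d0 ∧
    ∃ (Tr : Mdl A) (q : (P1 →ₗ[Aᵐᵒᵖ] A) →ₗ[A] Tr),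
      Function.Surjective q ∧
      (∀ g : P1 →ₗ[Aᵐᵒᵖ] A, q g = 0 ↔ ∃ f : P0 →ₗ[Aᵐᵒᵖ] A, g = f.comp d1) ∧
      IskDual k A T Tr

/-- `T = τ⁻¹ M`: the inverse Auslander–Reiten translate, `Tr (D M)`, computed
from a minimal projective presentation of the left module `D M`. -/
def IsTauInv (M T : Mdl Aᵐᵒᵖ) : Prop :=
  ∃ (DM : Mdl A), IskDual k A M DM ∧
  ∃ (Q1 Q0 : Mdl A) (d1 : Q1 →ₗ[A] Q0) (d0 : Q0 →ₗ[A] DM),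
    IsMinPres A d1 d0 ∧
    ∃ q : (Q1 →ₗ[A] A) →ₗ[Aᵐᵒᵖ] T,
      Function.Surjective q ∧
      ∀ g : Q1 →ₗ[A] A, q g = 0 ↔ ∃ f : Q0 →ₗ[A] A, g = f.comp d1

/-- `W = τ⁻¹ Ω⁻¹ M`. -/
def IsTauInvCosyz (M W : Mdl Aᵐᵒᵖ) : Prop :=
  ∃ V, IsCosyzygy Aᵐᵒᵖ M V ∧ IsTauInv k A V W

/-- `W = τ Ω M`. -/
def IsTauSyz (M W : Mdl Aᵐᵒᵖ) : Prop :=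
  ∃ V, IsSyzygy Aᵐᵒᵖ M V ∧ IsTau k A V W

/-- `M` is `τ`-rigid: `Hom(M, τM) = 0`. -/
def TauRigid (M : Mdl Aᵐᵒᵖ) : Prop :=
  ∀ T, IsTau k A M T → HomZero Aᵐᵒᵖ M T

/-- `M` is `τ`-tilting: `τ`-rigid with as many pairwise nonisomorphic
indecomposable summands as there are simple modules. -/
def TauTilting (M : Mdl Aᵐᵒᵖ) : Prop :=
  TauRigid k A M ∧
  ∃ (n : ℕ) (N : Fin n → Mdl Aᵐᵒᵖ),
    (∀ i, Indecomp Aᵐᵒᵖ (N i)) ∧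
    (∀ i j, Nonempty ((N i) ≃ₗ[Aᵐᵒᵖ] (N j)) → i = j) ∧
    Nonempty (M ≃ₗ[Aᵐᵒᵖ] ((i : Fin n) → N i)) ∧
    SimpleCount Aᵐᵒᵖ n

end Duality


section Alg

variable {C : Type} [Ring C]

/-- the map `p ↦ m · g(p)`. -/
def actHom {P M : Type} [AddCommGroup P] [Module Cᵐᵒᵖ P] [AddCommGroup M] [Module Cᵐᵒᵖ M]
    (m : M) (g : P →ₗ[Cᵐᵒᵖ] C) : P →ₗ[Cᵐᵒᵖ] M where
  toFun p := op (g p) • m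
  map_add' p q := by simp [add_smul]
  map_smul' r p := by
    simp only [map_smul, RingHom.id_apply]
    rw [← mul_smul]
    congr 1

theorem actHom_apply {P M : Type} [AddCommGroup P] [Module Cᵐᵒᵖ P] [AddCommGroup M]
    [Module Cᵐᵒᵖ M] (m : M) (g : P →ₗ[Cᵐᵒᵖ] C) (p : P) : actHom m g p = op (g p) • m := rfl

theorem exists_dualBasis (P : Type) [AddCommGroup P] [Module Cᵐᵒᵖ P] [Module.Finite Cᵐᵒᵖ P]
    [Module.Projective Cᵐᵒᵖ P] :
    ∃ (n : ℕ) (x : Fin n → P) (xs : Fin n → (P →ₗ[Cᵐᵒᵖ] C)),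
      ∀ p, ∑ i, op (xs i p) • x i = p := by
  obtain ⟨n, f, g, -, -, hfg⟩ := Module.Finite.exists_comp_eq_id_of_projective Cᵐᵒᵖ P
  let u : Cᵐᵒᵖ →ₗ[Cᵐᵒᵖ] C :=
    { toFun := unop
      map_add' := fun _ _ => rfl
      map_smul' := fun _ _ => rfl }
  refine ⟨n, fun i => f (Pi.single i 1), fun i => u ∘ₗ LinearMap.proj i ∘ₗ g, fun p => ?_⟩
  have : ∀ i, op ((u ∘ₗ LinearMap.proj i ∘ₗ g) p) = g p i := fun i => rfl
  simp only [this]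
  conv_rhs => rw [← LinearMap.id_apply (R := Cᵐᵒᵖ) p, ← hfg]
  rw [LinearMap.comp_apply, LinearMap.pi_apply_eq_sum_univ f]
  refine Finset.sum_congr rfl fun i _ => ?_
  congr 2
  ext j
  simp [Pi.single_apply, eq_comm]

theorem dualBasis_hom {P M : Type} [AddCommGroup P] [Module Cᵐᵒᵖ P] [AddCommGroup M]
    [Module Cᵐᵒᵖ M] {n : ℕ} {x : Fin n → P} {xs : Fin n → (P →ₗ[Cᵐᵒᵖ] C)}
    (hx : ∀ p, ∑ i, op (xs i p) • x i = p) (h : P →ₗ[Cᵐᵒᵖ] M) :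
    ∑ i, actHom (h (x i)) (xs i) = h := by
  ext p
  conv_rhs => rw [← hx p]
  simp [actHom_apply, LinearMap.sum_apply]

theorem dualBasis_dual {P : Type} [AddCommGroup P] [Module Cᵐᵒᵖ P]
    {n : ℕ} {x : Fin n → P} {xs : Fin n → (P →ₗ[Cᵐᵒᵖ] C)}
    (hx : ∀ p, ∑ i, op (xs i p) • x i = p) (g : P →ₗ[Cᵐᵒᵖ] C) :
    ∑ i, g (x i) • xs i = g := by
  ext p
  conv_rhs => rw [← hx p]
  simp [LinearMap.sum_apply]

theorem finite_dual (P : Type) [AddCommGroup P] [Module Cᵐᵒᵖ P] [Module.Finite Cᵐᵒᵖ P]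
    [Module.Projective Cᵐᵒᵖ P] : Module.Finite C (P →ₗ[Cᵐᵒᵖ] C) := by
  obtain ⟨n, x, xs, hx⟩ := exists_dualBasis (C := C) P
  classical
  refine ⟨⟨Finset.univ.image xs, ?_⟩⟩
  rw [eq_top_iff]
  intro g _
  rw [← dualBasis_dual hx g]
  refine Submodule.sum_mem _ fun i _ => Submodule.smul_mem _ _ (Submodule.subset_span ?_)
  simp

variable {k : Type} [Field k] [Algebra k C]

/-- The balanced nondegenerate pairing property. -/
structure IsPairing {W T : Type} [AddCommGroup W] [Module Cᵐᵒᵖ W] [AddCommGroup T] [Module C T]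
    (φ : W → T → k) : Prop where
  add_left : ∀ n n' m, φ (n + n') m = φ n m + φ n' m
  add_right : ∀ n m m', φ n (m + m') = φ n m + φ n m'
  smul_right : ∀ (c : k) n m, φ n ((algebraMap k C c) • m) = c * φ n m
  bal : ∀ (a : C) n m, φ (op a • n) m = φ n (a • m)
  nl : ∀ n, (∀ m, φ n m = 0) → n = 0
  nr : ∀ m, (∀ n, φ n m = 0) → m = 0

theorem IsPairing.surj [FiniteDimensional k C] {W T : Type} [AddCommGroup W] [Module Cᵐᵒᵖ W]
    [AddCommGroup T] [Module C T] [Module.Finite C T] {φ : W → T → k}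
    (h : IsPairing (C := C) φ) (b : T →+ k)
    (hb : ∀ (c : k) t, b (algebraMap k C c • t) = c * b t) :
    ∃ w, ∀ t, φ w t = b t := by
  let : Module k T := Module.compHom T (algebraMap k C)
  let : Module k W := Module.compHom W (algebraMap k Cᵐᵒᵖ)
  have eT : ∀ (c : k) (t : T), c • t = algebraMap k C c • t := fun _ _ => rfl
  have eW : ∀ (c : k) (t : W), c • t = op (algebraMap k C c) • t := fun _ _ => rfl
  have : IsScalarTower k C T := ⟨fun c a t => by rw [eT, Algebra.smul_def, mul_smul]⟩
  have : Module.Finite k T := Module.Finite.trans C T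
  let B : W →ₗ[k] T →ₗ[k] k := LinearMap.mk₂ k φ h.add_left
    (fun c n m => by rw [eW, h.bal, h.smul_right]; rfl) h.add_right
    (fun c n m => by rw [eT, h.smul_right]; rfl)
  have hinj : Function.Injective B.flip := by
    rw [injective_iff_map_eq_zero]
    intro t ht
    exact h.nr t fun n => by simpa [B] using LinearMap.congr_fun ht n
  have hs : Function.Surjective B := LinearMap.flip_injective_iff₂.1 hinj
  obtain ⟨w, hw⟩ := hs { b with map_smul' := fun c t => hb c t }
  exact ⟨w, fun t => LinearMap.congr_fun hw t⟩

theorem IsPairing.ext {W T : Type} [AddCommGroup W] [Module Cᵐᵒᵖ W]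
    [AddCommGroup T] [Module C T] {φ : W → T → k}
    (h : IsPairing (C := C) φ) {w w' : W} (e : ∀ t, φ w t = φ w' t) : w = w' := by
  refine sub_eq_zero.1 (h.nl _ fun t => ?_)
  have := h.add_left (w - w') w' t
  rw [sub_add_cancel, e] at this
  simpa using this

theorem IsPairing.repr [FiniteDimensional k C] {W T X : Type} [AddCommGroup W] [Module Cᵐᵒᵖ W]
    [AddCommGroup T] [Module C T] [Module.Finite C T] [AddCommGroup X] [Module Cᵐᵒᵖ X]
    {φ : W → T → k}
    (h : IsPairing (C := C) φ) (b : X → T →+ k)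
    (hadd : ∀ x y t, b (x + y) t = b x t + b y t)
    (hbal : ∀ (c : C) x t, b (op c • x) t = b x (c • t))
    (hb : ∀ (c : k) x t, b x (algebraMap k C c • t) = c * b x t) :
    ∃ f : X →ₗ[Cᵐᵒᵖ] W, ∀ x t, φ (f x) t = b x t := by
  choose f hf using fun x => h.surj (b x) (fun c t => hb c x t)
  refine ⟨{ toFun := f, map_add' := ?_, map_smul' := ?_ }, hf⟩
  · intro x y
    refine h.ext fun t => ?_
    rw [h.add_left, hf, hf, hf, hadd]
  · intro c x
    refine h.ext fun t => ?_
    induction c with | _ c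
    rw [RingHom.id_apply, h.bal, hf, hf, hbal]

theorem IsPairing.hom_zero_iff [FiniteDimensional k C] {W T M P0 P1 : Type}
    [AddCommGroup W] [Module Cᵐᵒᵖ W]
    [AddCommGroup T] [Module C T] [AddCommGroup M] [Module Cᵐᵒᵖ M]
    [AddCommGroup P0] [Module Cᵐᵒᵖ P0] [Module.Finite Cᵐᵒᵖ P0] [Module.Projective Cᵐᵒᵖ P0]
    [AddCommGroup P1] [Module Cᵐᵒᵖ P1] [Module.Finite Cᵐᵒᵖ P1] [Module.Projective Cᵐᵒᵖ P1]
    {φ : W → T → k} (hφ : IsPairing (C := C) φ) (d1 : P1 →ₗ[Cᵐᵒᵖ] P0)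
    (q : (P1 →ₗ[Cᵐᵒᵖ] C) →ₗ[C] T) (hq : Function.Surjective q)
    (hq0 : ∀ g : P1 →ₗ[Cᵐᵒᵖ] C, q g = 0 ↔ ∃ f : P0 →ₗ[Cᵐᵒᵖ] C, g = f.comp d1) :
    (∀ f : M →ₗ[Cᵐᵒᵖ] W, f = 0) ↔
      ∀ h : P1 →ₗ[Cᵐᵒᵖ] M, ∃ h' : P0 →ₗ[Cᵐᵒᵖ] M, h = h'.comp d1 := by
  obtain ⟨n, x, xs, hx⟩ := exists_dualBasis (C := C) P1
  obtain ⟨n', y, ys, hy⟩ := exists_dualBasis (C := C) P0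
  have := finite_dual (C := C) P1
  have : Module.Finite C T := Module.Finite.of_surjective q hq
  have φz : ∀ w, φ w 0 = 0 := fun w => by
    have := hφ.add_right w 0 0
    simpa using this
  constructor
  · intro hz
    let : Module k M := Module.compHom M (algebraMap k Cᵐᵒᵖ)
    have eM : ∀ (c : k) (t : M), c • t = op (algebraMap k C c) • t := fun _ _ => rfl
    have : IsScalarTower k Cᵐᵒᵖ M :=
      ⟨fun c a t => by rw [eM, Algebra.smul_def, mul_smul]; rfl⟩
    have : SMulCommClass Cᵐᵒᵖ k M := IsScalarTower.to_smulCommClass'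
    let res : (P0 →ₗ[Cᵐᵒᵖ] M) →ₗ[k] (P1 →ₗ[Cᵐᵒᵖ] M) :=
      { toFun := fun h => h.comp d1
        map_add' := fun _ _ => rfl
        map_smul' := fun _ _ => rfl }
    by_contra hne
    push Not at hne
    obtain ⟨h, hh⟩ := hne
    have hmem : h ∉ LinearMap.range res := by
      rintro ⟨h', e⟩
      exact hh h' e.symm
    obtain ⟨θ, hθ, hθ0⟩ := Submodule.exists_dual_map_eq_bot_of_notMem hmem inferInstance
    have hθr : ∀ h' : P0 →ₗ[Cᵐᵒᵖ] M, θ (h'.comp d1) = 0 := by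
      intro h'
      have : θ (res h') ∈ (LinearMap.range res).map θ :=
        Submodule.mem_map_of_mem (LinearMap.mem_range_self _ _)
      rw [hθ0] at this
      exact (Submodule.mem_bot k).1 this
    have hker : ∀ m (g : P1 →ₗ[Cᵐᵒᵖ] C), q g = 0 → θ (actHom m g) = 0 := by
      intro m g hg
      obtain ⟨f, rfl⟩ := (hq0 g).1 hg
      exact hθr (actHom m f)
    let a : M → (P1 →ₗ[Cᵐᵒᵖ] C) →+ k := fun m =>
      { toFun := fun g => θ (actHom m g)
        map_zero' := hker m 0 (map_zero q)
        map_add' := fun g g' => by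
          rw [← map_add]
          congr 1
          ext p
          simp [actHom_apply, add_smul] }
    have aq : ∀ m g g', q g = q g' → a m g = a m g' := by
      intro m g g' e
      refine sub_eq_zero.1 ?_
      rw [← map_sub]
      exact hker m _ (by rw [map_sub, e, sub_self])
    let s := Function.surjInv hq
    have hs : ∀ t, q (s t) = t := Function.surjInv_eq hq
    let b : M → T →+ k := fun m =>
      { toFun := fun t => a m (s t)
        map_zero' := by rw [aq m (s 0) 0 (by rw [hs, map_zero]), map_zero]
        map_add' := fun t t' => by
          rw [aq m (s (t + t')) (s t + s t') (by rw [map_add, hs, hs, hs]), map_add] }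
    have hbq : ∀ m g, b m (q g) = θ (actHom m g) := fun m g => aq m _ _ (hs _)
    have hbal : ∀ (c : C) m t, b (op c • m) t = b m (c • t) := by
      intro c m t
      obtain ⟨g, rfl⟩ := hq t
      rw [← map_smul, hbq, hbq]
      congr 1
      ext p
      simp [actHom_apply, ← mul_smul]
    obtain ⟨f, hf⟩ := hφ.repr b
      (fun m m' t => by
        obtain ⟨g, rfl⟩ := hq t
        rw [hbq, hbq, hbq, ← map_add]
        congr 1
        ext p
        simp [actHom_apply])
      hbal
      (fun c m t => by
        rw [← hbal]
        obtain ⟨g, rfl⟩ := hq t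
        rw [hbq, hbq, ← smul_eq_mul, ← map_smul]
        congr 1
        ext p
        simp only [actHom_apply, LinearMap.smul_apply]
        rw [← eM, smul_comm])
    apply hθ
    rw [← dualBasis_hom hx h, map_sum]
    refine Finset.sum_eq_zero fun i _ => ?_
    rw [← hbq, ← hf, hz f]
    have := hφ.add_left 0 0 (q (xs i))
    simpa using this
  · intro hext f
    ext m
    rw [LinearMap.zero_apply]
    refine hφ.nl _ fun t => ?_
    obtain ⟨g, rfl⟩ := hq t
    let qφ : W → T →+ k := fun w => { toFun := φ w, map_zero' := φz w, map_add' := hφ.add_right w }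
    let φr : T → W →+ k := fun t =>
      { toFun := fun w => φ w t
        map_zero' := by
          have := hφ.add_left 0 0 t
          simpa using this
        map_add' := fun w w' => hφ.add_left w w' t }
    let Θ : (P1 →ₗ[Cᵐᵒᵖ] M) → k := fun h => ∑ i, φ (f (h (x i))) (q (xs i))
    have hΘ : ∀ m g, Θ (actHom m g) = φ (f m) (q g) := by
      intro m g
      conv_rhs => rw [← dualBasis_dual hx g]
      rw [map_sum]
      change _ = qφ (f m) _
      rw [map_sum]
      refine Finset.sum_congr rfl fun i _ => ?_
      rw [actHom_apply, map_smul, hφ.bal, map_smul]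
      rfl
    have hΘs : ∀ (h : Fin n' → (P1 →ₗ[Cᵐᵒᵖ] M)), Θ (∑ j, h j) = ∑ j, Θ (h j) := by
      intro h
      simp only [Θ]
      rw [Finset.sum_comm]
      refine Finset.sum_congr rfl fun i _ => ?_
      rw [LinearMap.sum_apply, map_sum]
      exact map_sum (φr (q (xs i))) _ _
    rw [← hΘ]
    obtain ⟨h', e⟩ := hext (actHom m g)
    rw [e, ← dualBasis_hom hy h']
    have : (∑ i, actHom (h' (y i)) (ys i)).comp d1
        = ∑ i, actHom (h' (y i)) ((ys i).comp d1) := by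
      ext p
      simp [actHom_apply, LinearMap.sum_apply]
    rw [this, hΘs]
    refine Finset.sum_eq_zero fun j _ => ?_
    rw [hΘ, (hq0 _).2 ⟨_, rfl⟩, φz]

end Alg

section Hom

open CategoryTheory.Abelian

variable {R : Type} [Ring R]

/-- short complex from linear maps -/
abbrev seqOf {X Y Z : Mdl R} (f : X →ₗ[R] Y) (g : Y →ₗ[R] Z)
    (h : LinearMap.range f = LinearMap.ker g) : ShortComplex (ModuleCat.{0} R) where
  f := ModuleCat.ofHom f
  g := ModuleCat.ofHom g
  zero := by
    ext x
    have : f x ∈ LinearMap.ker g := h ▸ LinearMap.mem_range_self f x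
    simpa using this

theorem seqOf_shortExact {X Y Z : Mdl R} (f : X →ₗ[R] Y) (g : Y →ₗ[R] Z)
    (h : LinearMap.range f = LinearMap.ker g) (hf : Function.Injective f)
    (hg : Function.Surjective g) : (seqOf f g h).ShortExact :=
  ModuleCat.shortComplex_shortExact _ (LinearMap.exact_iff.2 h.symm) hf hg

theorem projDim_of_PdLE2 {M : Mdl R} (h : PdLE2 R M) : HasProjectiveDimensionLT M 3 := by
  obtain ⟨P2, P1, P0, d2, d1, d0, hP2, hP1, hP0, i2, s0, e21, e10⟩ := h
  let K : Mdl R := ModuleCat.of R (LinearMap.ker d0)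
  let d1' : P1 →ₗ[R] K := d1.codRestrict (LinearMap.ker d0)
    (fun x => e10 ▸ LinearMap.mem_range_self d1 x)
  have hs : Function.Surjective d1' := by
    rintro ⟨y, hy⟩
    rw [← e10] at hy
    obtain ⟨x, rfl⟩ := hy
    exact ⟨x, rfl⟩
  have hk : LinearMap.range d2 = LinearMap.ker d1' := by
    rw [e21]
    exact (LinearMap.ker_codRestrict _ _ _).symm
  have A := seqOf_shortExact d2 d1' hk i2 hs
  have B := seqOf_shortExact (X := K) (LinearMap.ker d0).subtype d0
    (Submodule.range_subtype _) (Submodule.subtype_injective _) s0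
  have hK : HasProjectiveDimensionLT K 2 := A.hasProjectiveDimensionLT_X₃ 1
    (inferInstanceAs (HasProjectiveDimensionLT P2 1))
    (inferInstanceAs (HasProjectiveDimensionLT P1 (1 + 1)))
  exact B.hasProjectiveDimensionLT_X₃ 2 hK
    (inferInstanceAs (HasProjectiveDimensionLT P0 (1 + 2)))

theorem injDim_of_IdLE1 {M : Mdl R} (h : IdLE1 R M) : HasInjectiveDimensionLT M 2 := by
  obtain ⟨I0, I1, d0, d1, h0, h1, i0, s1, e⟩ := h
  have A := seqOf_shortExact d0 d1 e i0 s1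
  have : Injective I0 := Module.injective_object_of_injective_module R I0
  have : Injective I1 := Module.injective_object_of_injective_module R I1
  exact A.hasInjectiveDimensionLT_X₁ 1
    (inferInstanceAs (HasInjectiveDimensionLT I1 1))
    (inferInstanceAs (HasInjectiveDimensionLT I0 (1 + 1)))

theorem ext_succ_of_injective_middle {S : ShortComplex (ModuleCat.{0} R)} (hS : S.ShortExact)
    [Injective S.X₂] (X : Mdl R) (hz : ∀ e : Ext X S.X₁ 2, e = 0) (e : Ext X S.X₃ 1) : e = 0 := by
  obtain ⟨x₂, rfl⟩ := Ext.covariant_sequence_exact₃ X hS e (n₁ := 2) rfl (hz _)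
  rw [Ext.eq_zero_of_injective x₂, Ext.zero_comp]

theorem extends_of_ext_one_zero {S : ShortComplex (ModuleCat.{0} R)} (hS : S.ShortExact)
    (M : Mdl R) (hz : ∀ e : Ext S.X₃ M 1, e = 0) (h : S.X₁ ⟶ M) :
    ∃ h' : S.X₂ ⟶ M, S.f ≫ h' = h := by
  obtain ⟨x₂, hx⟩ := Ext.contravariant_sequence_exact₁ hS M (Ext.mk₀ h) (n₁ := 1) rfl (hz _)
  obtain ⟨h', rfl⟩ := Ext.homEquiv₀.symm.surjective x₂
  refine ⟨h', ?_⟩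
  apply Ext.homEquiv₀.symm.injective
  exact (Ext.mk₀_comp_mk₀ _ _).symm.trans hx

theorem ext_one_zero_of_extends {S : ShortComplex (ModuleCat.{0} R)} (hS : S.ShortExact)
    [Projective S.X₂] (M : Mdl R) (hz : ∀ h : S.X₁ ⟶ M, ∃ h' : S.X₂ ⟶ M, S.f ≫ h' = h)
    (e : Ext S.X₃ M 1) : e = 0 := by
  obtain ⟨x, rfl⟩ := precomp_extClass_surjective_of_projective_X₂ M hS 0 e
  obtain ⟨h, rfl⟩ := Ext.homEquiv₀.symm.surjective x
  obtain ⟨h', rfl⟩ := hz h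
  change hS.extClass.comp (Ext.mk₀ (S.f ≫ h')) (add_comm 1 0) = 0
  rw [← Ext.mk₀_comp_mk₀]
  exact hS.extClass_comp_assoc _

theorem ext_two_iff {S : ShortComplex (ModuleCat.{0} R)} (hS : S.ShortExact)
    [Projective S.X₂] (M : Mdl R) :
    (∀ e : Ext S.X₃ M 2, e = 0) ↔ (∀ e : Ext S.X₁ M 1, e = 0) := by
  constructor
  · intro h e
    obtain ⟨x₂, rfl⟩ := Ext.contravariant_sequence_exact₁ hS M e (n₁ := 2) rfl (h _)
    rw [Ext.eq_zero_of_projective x₂, Ext.comp_zero]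
  · intro h e
    obtain ⟨x, rfl⟩ := precomp_extClass_surjective_of_projective_X₂ M hS 1 e
    rw [h x, map_zero]

/-- If `Ext²(X, M) = 0` for all finitely generated `X`, then `id M ≤ 1`. -/
theorem IdLE1_of_ext {M : Mdl R}
    (h : ∀ X : Mdl R, Module.Finite R X → ∀ e : Ext X M 2, e = 0) : IdLE1 R M := by
  obtain ⟨I, hI, f, hf⟩ := EnoughInjectives.presentation M
  have injf : Function.Injective f.hom := (ModuleCat.mono_iff_injective f).mp hf
  let Q : Mdl R := ModuleCat.of R (I ⧸ LinearMap.range f.hom)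
  let p : I →ₗ[R] Q := (LinearMap.range f.hom).mkQ
  have hp : Function.Surjective p := Submodule.mkQ_surjective _
  have hk : LinearMap.range f.hom = LinearMap.ker p := (Submodule.ker_mkQ _).symm
  have hS := seqOf_shortExact f.hom p hk injf hp
  have hIm : Module.Injective R I := Module.injective_module_of_injective_object R I
  refine ⟨I, Q, f.hom, p, hIm, ?_, injf, hp, hk⟩
  apply Module.Baer.injective
  intro J g
  let RJ : Mdl R := ModuleCat.of R (R ⧸ J)
  have hT := seqOf_shortExact (X := ModuleCat.of R J) (Y := ModuleCat.of R R) (Z := RJ)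
    (Submodule.subtype J) (Submodule.mkQ J) ((Submodule.range_subtype _).trans (Submodule.ker_mkQ _).symm) (Submodule.subtype_injective J)
    (Submodule.mkQ_surjective J)
  have hfin : Module.Finite R RJ := inferInstanceAs (Module.Finite R (R ⧸ J))
  have hz : ∀ e : Ext RJ Q 1, e = 0 := fun e =>
    have : Injective (seqOf f.hom p hk).X₂ := hI
    ext_succ_of_injective_middle hS RJ (h RJ hfin) e
  obtain ⟨g', hg'⟩ := extends_of_ext_one_zero hT Q hz (ModuleCat.ofHom g)
  refine ⟨g'.hom, fun x hx => ?_⟩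
  exact LinearMap.congr_fun (congrArg ModuleCat.Hom.hom hg') ⟨x, hx⟩

theorem ext_pow_zero {M D : Mdl R} (h : ∀ e : Ext D M 2, e = 0) (n : ℕ)
    (e : Ext (ModuleCat.of R (Fin n → D)) M 2) : e = 0 := by
  let π : ∀ i : Fin n, ModuleCat.of R (Fin n → D) ⟶ D := fun i =>
    ModuleCat.ofHom (LinearMap.proj i)
  let ι : ∀ i : Fin n, D ⟶ ModuleCat.of R (Fin n → D) := fun i =>
    ModuleCat.ofHom (LinearMap.single R (fun _ => D) i)
  have hid : ∑ i, π i ≫ ι i = 𝟙 (ModuleCat.of R (Fin n → D)) := by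
    refine ModuleCat.hom_ext (LinearMap.ext fun x => ?_)
    rw [ModuleCat.hom_sum, LinearMap.sum_apply]
    exact Finset.univ_sum_single x
  rw [← Ext.mk₀_id_comp e, ← hid, Ext.mk₀_sum, Ext.sum_comp]
  refine Finset.sum_eq_zero fun i _ => ?_
  rw [← Ext.mk₀_comp_mk₀, Ext.comp_assoc (Ext.mk₀ (π i)) (Ext.mk₀ (ι i)) e (zero_add 0)
    (zero_add 2) (by omega), h ((Ext.mk₀ (ι i)).comp e (zero_add 2)), Ext.comp_zero]

theorem ext_two_of_embedding {M X Y : Mdl R} (hgl : GlDimLE2 R) (j : X →ₗ[R] Y)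
    (hj : Function.Injective j) (h : ∀ e : Ext Y M 2, e = 0) (e : Ext X M 2) : e = 0 := by
  let Q : Mdl R := ModuleCat.of R (Y ⧸ LinearMap.range j)
  have hS := seqOf_shortExact (Z := Q) j (LinearMap.range j).mkQ (Submodule.ker_mkQ _).symm hj
    (Submodule.mkQ_surjective _)
  have := projDim_of_PdLE2 (hgl Q)
  obtain ⟨x₂, rfl⟩ := Ext.contravariant_sequence_exact₁ hS M e (n₁ := 3) rfl
    (Ext.eq_zero_of_hasProjectiveDimensionLT (X := Q) _ 3 le_rfl)
  rw [h x₂, Ext.comp_zero]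

theorem finite_of_superfluous {P X : Type} [AddCommGroup P] [Module R P] [AddCommGroup X]
    [Module R X] [Module.Finite R X] (f : P →ₗ[R] X) (hf : Function.Surjective f)
    (hs : ∀ N : Submodule R P, N ⊔ LinearMap.ker f = ⊤ → N = ⊤) : Module.Finite R P := by
  obtain ⟨s, hs'⟩ := Module.Finite.fg_top (R := R) (M := X)
  have hmap : (Submodule.span R (Function.surjInv hf '' (s : Set X))).map f = ⊤ := by
    rw [Submodule.map_span, ← Set.image_comp]
    have : (⇑f ∘ Function.surjInv hf) = id := funext (Function.surjInv_eq hf)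
    rw [this, Set.image_id, hs']
  have hN := hs (Submodule.span R (Function.surjInv hf '' (s : Set X))) (by
    rw [← Submodule.comap_map_eq, hmap, Submodule.comap_top])
  refine ⟨?_⟩
  rw [← hN]
  exact Submodule.fg_span (s.finite_toSet.image _)

end Hom
section Main

open CategoryTheory.Abelian

variable {k : Type} [Field k] {C : Type} [Ring C] [Algebra k C] [FiniteDimensional k C]

variable (k C) in
theorem finite_op : Module.Finite k Cᵐᵒᵖ := Module.Finite.equiv (MulOpposite.opLinearEquiv k)

theorem noeth_op (k : Type) [Field k] (C : Type) [Ring C] [Algebra k C]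
    [FiniteDimensional k C] : IsNoetherianRing Cᵐᵒᵖ :=
  have := finite_op k C
  isNoetherian_of_tower k inferInstance

theorem IsPairing.finite_left {W T : Type} [AddCommGroup W] [Module Cᵐᵒᵖ W]
    [AddCommGroup T] [Module C T] [Module.Finite C T] {φ : W → T → k}
    (h : IsPairing (C := C) φ) : Module.Finite Cᵐᵒᵖ W := by
  let : Module k T := Module.compHom T (algebraMap k C)
  let : Module k W := Module.compHom W (algebraMap k Cᵐᵒᵖ)
  have eT : ∀ (c : k) (t : T), c • t = algebraMap k C c • t := fun _ _ => rfl
  have eW : ∀ (c : k) (t : W), c • t = op (algebraMap k C c) • t := fun _ _ => rfl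
  have : IsScalarTower k C T := ⟨fun c a t => by rw [eT, Algebra.smul_def, mul_smul]⟩
  have : IsScalarTower k Cᵐᵒᵖ W := ⟨fun c a t => by
    rw [eW, Algebra.smul_def, mul_smul]; rfl⟩
  have : Module.Finite k T := Module.Finite.trans C T
  let B : W →ₗ[k] T →ₗ[k] k := LinearMap.mk₂ k φ h.add_left
    (fun c n m => by rw [eW, h.bal, h.smul_right]; rfl) h.add_right
    (fun c n m => by rw [eT, h.smul_right]; rfl)
  have hinj : Function.Injective B := by
    rw [injective_iff_map_eq_zero]
    intro t ht
    exact h.nl t fun n => by simpa [B] using LinearMap.congr_fun ht n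
  have : Module.Finite k W := Module.Finite.of_injective B hinj
  exact Module.Finite.of_restrictScalars_finite k Cᵐᵒᵖ W

/-- every finitely generated module embeds in a finite power of `DC`. -/
theorem IsPairing.embed {D X : Type} [AddCommGroup D] [Module Cᵐᵒᵖ D]
    {φ : D → C → k} (h : IsPairing (C := C) φ) [AddCommGroup X] [Module Cᵐᵒᵖ X]
    [Module.Finite Cᵐᵒᵖ X] :
    ∃ (n : ℕ) (j : X →ₗ[Cᵐᵒᵖ] (Fin n → D)), Function.Injective j := by
  let : Module k X := Module.compHom X (algebraMap k Cᵐᵒᵖ)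
  have eX : ∀ (c : k) (t : X), c • t = op (algebraMap k C c) • t := fun _ _ => rfl
  have : IsScalarTower k Cᵐᵒᵖ X := ⟨fun c a t => by
    rw [eX, Algebra.smul_def, mul_smul]; rfl⟩
  have := finite_op k C
  have : Module.Finite k X := Module.Finite.trans Cᵐᵒᵖ X
  let bs := Module.finBasis k X
  have key : ∀ i, ∃ f : X →ₗ[Cᵐᵒᵖ] D, ∀ (x : X) (t : C), φ (f x) t = bs.coord i (op t • x) := by
    intro i
    refine h.repr (fun x => AddMonoidHom.mk' (fun t => bs.coord i (op t • x)) ?_) ?_ ?_ ?_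
    · intro a b
      rw [MulOpposite.op_add, add_smul, map_add]
    · intro x y t
      change bs.coord i (op t • (x + y)) = bs.coord i (op t • x) + bs.coord i (op t • y)
      rw [smul_add, map_add]
    · intro c x t
      change bs.coord i (op t • op c • x) = bs.coord i (op (c * t) • x)
      rw [op_mul, mul_smul]
    · intro c x t
      change bs.coord i (op (algebraMap k C c * t) • x) = c * bs.coord i (op t • x)
      rw [Algebra.commutes, op_mul, mul_smul, ← eX, map_smul, smul_eq_mul]
  choose f hf using key
  refine ⟨_, LinearMap.pi f, ?_⟩
  rw [injective_iff_map_eq_zero]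
  intro x hx
  refine (bs.forall_coord_eq_zero_iff).1 fun i => ?_
  have h1 := hf i x 1
  have h0 : f i x = 0 := congrFun hx i
  rw [h0, op_one, one_smul] at h1
  rw [← h1]
  have := h.add_left 0 0 1
  rw [add_zero] at this
  simpa using this

/-- A minimal presentation of a module of projective dimension at most one is injective. -/
theorem minPres_injective {R : Type} [Ring R] {P1 P0 V : Mdl R} {d1 : P1 →ₗ[R] P0}
    {d0 : P0 →ₗ[R] V} (h : IsMinPres R d1 d0) (hV : HasProjectiveDimensionLT V 2) :
    Function.Injective d1 := by
  obtain ⟨⟨hP0, s0, -⟩, hP1, e, hs⟩ := h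
  let K : Mdl R := ModuleCat.of R (LinearMap.ker d0)
  have B := seqOf_shortExact (X := K) (LinearMap.ker d0).subtype d0
    (Submodule.range_subtype _) (Submodule.subtype_injective _) s0
  have hK : HasProjectiveDimensionLT K 1 := B.hasProjectiveDimensionLT_X₁ 1
    (inferInstanceAs (HasProjectiveDimensionLT P0 1)) hV
  have hKp : Projective K := (projective_iff_hasProjectiveDimensionLT_one).2 hK
  have hKm : Module.Projective R K := (IsProjective.iff_projective K).2 hKp
  let d1' : P1 →ₗ[R] K := d1.codRestrict (LinearMap.ker d0)
    (fun x => e ▸ LinearMap.mem_range_self d1 x)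
  have hsur : Function.Surjective d1' := by
    rintro ⟨y, hy⟩
    rw [← e] at hy
    obtain ⟨x, rfl⟩ := hy
    exact ⟨x, rfl⟩
  have hker : LinearMap.ker d1' = LinearMap.ker d1 := LinearMap.ker_codRestrict _ _ _
  obtain ⟨s, hsec⟩ := Module.projective_lifting_property d1' LinearMap.id hsur
  have hsec' : ∀ x, d1' (s x) = x := fun x => LinearMap.congr_fun hsec x
  have htop : LinearMap.range s = ⊤ := by
    apply hs
    rw [← hker, eq_top_iff]
    intro x _
    have : x = s (d1' x) + (x - s (d1' x)) := by abel
    rw [this]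
    refine Submodule.add_mem_sup (LinearMap.mem_range_self s _) ?_
    rw [LinearMap.mem_ker, map_sub, hsec', sub_self]
  rw [← LinearMap.ker_eq_bot, ← hker, LinearMap.ker_eq_bot, injective_iff_map_eq_zero]
  intro x hx
  obtain ⟨y, rfl⟩ := LinearMap.range_eq_top.1 htop x
  rw [hsec'] at hx
  rw [hx, map_zero]

end Main
/-- For an algebra `C` of global dimension exactly 2 and a module `M`,
`id_C M ≤ 1` iff `Hom_C(M, τ Ω (D C)) = 0`. -/
theorem id_le_one_iff_hom_vanish
    (k : Type) [Field k] (C : Type) [Ring C] [Algebra k C] [FiniteDimensional k C]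
    (hgl : GlDimEq2 Cᵐᵒᵖ)
    (M : Mdl Cᵐᵒᵖ) [Module.Finite Cᵐᵒᵖ M]
    (DC : Mdl Cᵐᵒᵖ) (hDC : IskDual k C DC (ModuleCat.of C C))
    (W : Mdl Cᵐᵒᵖ) (hW : IsTauSyz k C DC W) :
    IdLE1 Cᵐᵒᵖ M ↔ HomZero Cᵐᵒᵖ M W := by
  obtain ⟨φ, a1, a2, a3, a4, a5, a6⟩ := hDC
  have hφ : IsPairing (C := C) (W := DC) (T := C) φ := ⟨a1, a2, a3, a4, a5, a6⟩
  obtain ⟨V, ⟨P, f, ⟨hP, sf, hsf⟩, ⟨e⟩⟩, P1, P0, d1, d0, hmin, Tr, q, hq, hq0,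
    ψ, b1, b2, b3, b4, b5, b6⟩ := hW
  have hψ : IsPairing (C := C) (W := W) (T := Tr) ψ := ⟨b1, b2, b3, b4, b5, b6⟩
  have hN := noeth_op k C
  have hDCf : Module.Finite Cᵐᵒᵖ DC := hφ.finite_left
  have hPf : Module.Finite Cᵐᵒᵖ P := finite_of_superfluous f sf hsf
  have hVf : Module.Finite Cᵐᵒᵖ V := Module.Finite.equiv e.symm
  obtain ⟨⟨hP0, s0, hs0⟩, hP1, e10, hs1⟩ := id hmin
  have hP0f : Module.Finite Cᵐᵒᵖ P0 := finite_of_superfluous d0 s0 hs0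
  have hP1f : Module.Finite Cᵐᵒᵖ P1 := by
    refine finite_of_superfluous d1.rangeRestrict d1.surjective_rangeRestrict ?_
    rw [LinearMap.ker_rangeRestrict]
    exact hs1
  let j : V →ₗ[Cᵐᵒᵖ] P := (LinearMap.ker f).subtype.comp e.toLinearMap
  have hj : Function.Injective j := (Submodule.subtype_injective _).comp e.injective
  have hjr : LinearMap.range j = LinearMap.ker f := by
    rw [LinearMap.range_comp, LinearEquiv.range, Submodule.map_top, Submodule.range_subtype]
  have hS := seqOf_shortExact j f hjr hj sf
  have hVpd : HasProjectiveDimensionLT V 2 := hS.hasProjectiveDimensionLT_X₁ 2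
    (inferInstanceAs (HasProjectiveDimensionLT P (1 + 1))) (projDim_of_PdLE2 (hgl.1 DC))
  have hd1 := minPres_injective hmin hVpd
  have hT := seqOf_shortExact d1 d0 e10 hd1 s0
  have i1 : Projective (seqOf j f hjr).X₂ := inferInstanceAs (Projective P)
  have i2 : Projective (seqOf d1 d0 e10).X₂ := inferInstanceAs (Projective P0)
  have key : (∀ x : Abelian.Ext DC M 2, x = 0) ↔ HomZero Cᵐᵒᵖ M W := by
    refine (ext_two_iff hS M).trans (Iff.trans ?_ (hψ.hom_zero_iff d1 q hq hq0).symm)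
    constructor
    · intro hz h
      obtain ⟨h', hh⟩ := extends_of_ext_one_zero hT M hz (ModuleCat.ofHom h)
      exact ⟨h'.hom, (congrArg ModuleCat.Hom.hom hh).symm⟩
    · intro hz
      refine ext_one_zero_of_extends hT M fun h => ?_
      obtain ⟨h', hh⟩ := hz h.hom
      exact ⟨ModuleCat.ofHom h', ModuleCat.hom_ext hh.symm⟩
  rw [← key]
  constructor
  · intro h x
    have := injDim_of_IdLE1 h
    exact Abelian.Ext.eq_zero_of_hasInjectiveDimensionLT x 2 le_rfl
  · intro h
    refine IdLE1_of_ext fun X hX x => ?_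
    obtain ⟨n, u, hu⟩ := hφ.embed (X := X)
    exact ext_two_of_embedding (Y := ModuleCat.of Cᵐᵒᵖ (Fin n → DC)) hgl.1 u hu
      (ext_pow_zero h n) x
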